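/- arXiv:1410.4153 — 2 statements merged into one kernel-verified Lean document; each statement's English description precedes it below -/
import Mathlib

section
/- For every τ in the complex upper half-plane, θ[1,3/5](τ)·θ[1/5,1/5](τ)³ = −θ[3/5,7/5](τ)³·θ[1/5,1](τ) + θ[3/5,9/5](τ)³·θ[1/5,7/5](τ). -/
open Complex

/-- The theta constant with characteristic `[ε; ε']`:
`θ[ε,ε'](τ) = ∑_{n ∈ ℤ} exp(2πi((1/2)(n+ε/2)²τ + (n+ε/2)(ε'/2)))`. -/
noncomputable def θ (ε ε' : ℝ) (τ : ℂ) : ℂ :=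
  ∑' n : ℤ, Complex.exp (2 * Real.pi * Complex.I *
    ((1 / 2) * ((n : ℂ) + (ε : ℂ) / 2) ^ 2 * τ + ((n : ℂ) + (ε : ℂ) / 2) * ((ε' : ℂ) / 2)))

/-- `ζ₅ = exp(2πi/5)`. -/
noncomputable def ζ₅ : ℂ := Complex.exp (2 * Real.pi * Complex.I / 5)

/-- The summand of the series defining `θ`. -/
noncomputable def thetaTerm (ε ε' : ℝ) (τ : ℂ) (n : ℤ) : ℂ :=
  Complex.exp (2 * Real.pi * Complex.I *
    ((1 / 2) * ((n : ℂ) + (ε : ℂ) / 2) ^ 2 * τ + ((n : ℂ) + (ε : ℂ) / 2) * ((ε' : ℂ) / 2)))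

lemma theta_eq_tsum (ε ε' : ℝ) (τ : ℂ) : θ ε ε' τ = ∑' n : ℤ, thetaTerm ε ε' τ n := rfl

lemma summable_thetaTerm (ε ε' : ℝ) {τ : ℂ} (hτ : 0 < τ.im) : Summable (thetaTerm ε ε' τ) := by
  have h := ((summable_jacobiTheta₂_term_iff ((ε * τ + ε') / 2) τ).mpr hτ).mul_left
    (cexp (2 * Real.pi * I * (ε ^ 2 / 8 * τ + ε * ε' / 4)))
  refine h.congr fun n => ?_
  rw [jacobiTheta₂_term, thetaTerm, ← Complex.exp_add]
  congr 1
  ring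

lemma theta_add_two_left (ε ε' : ℝ) (τ : ℂ) : θ (ε + 2) ε' τ = θ ε ε' τ := by
  rw [theta_eq_tsum, theta_eq_tsum, ← (Equiv.addRight (1 : ℤ)).tsum_eq (thetaTerm ε ε' τ)]
  refine tsum_congr fun n => ?_
  simp only [thetaTerm, Equiv.coe_addRight]
  congr 1
  push_cast
  ring

lemma theta_sub_two_right (ε ε' : ℝ) (τ : ℂ) :
    θ ε (ε' - 2) τ = cexp (2 * Real.pi * I * (-ε / 2)) * θ ε ε' τ := by
  rw [theta_eq_tsum, theta_eq_tsum, ← tsum_mul_left]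
  refine tsum_congr fun n => ?_
  simp only [thetaTerm, ← Complex.exp_add]
  rw [Complex.exp_eq_exp_iff_exists_int]
  refine ⟨-n, ?_⟩
  push_cast
  ring

lemma theta_neg (ε ε' : ℝ) (τ : ℂ) : θ (-ε) (-ε') τ = θ ε ε' τ := by
  rw [theta_eq_tsum, theta_eq_tsum, ← (Equiv.neg ℤ).tsum_eq (thetaTerm ε ε' τ)]
  refine tsum_congr fun n => ?_
  simp only [thetaTerm, Equiv.neg_apply]
  congr 1
  push_cast
  ring

lemma theta_two_sub_neg (ε ε' : ℝ) (τ : ℂ) : θ (2 - ε) (-ε') τ = θ ε ε' τ := by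
  rw [sub_eq_neg_add, theta_add_two_left, theta_neg]

lemma theta_two_sub_two_sub (ε ε' : ℝ) (τ : ℂ) :
    θ (2 - ε) (2 - ε') τ = cexp (2 * Real.pi * I * (-ε / 2)) * θ ε ε' τ := by
  rw [← theta_sub_two_right, ← neg_sub ε' 2, theta_two_sub_neg]

/-- The index change `(k, l) ↦ (m, n)` on `ℤ × ℤ`, split according to the parity of `m - n`. -/
noncomputable def intProdSumEquiv : (ℤ × ℤ) ⊕ (ℤ × ℤ) ≃ ℤ × ℤ :=
  Equiv.ofBijective
    (Sum.elim (fun p => (p.1 + p.2, p.1 - p.2 - 1)) (fun p => (p.1 + p.2, p.1 - p.2))) <| by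
  constructor
  · rintro (⟨a, b⟩ | ⟨a, b⟩) (⟨c, d⟩ | ⟨c, d⟩) h <;>
      simp only [Sum.elim_inl, Sum.elim_inr, Prod.mk.injEq] at h
    · rw [show a = c by omega, show b = d by omega]
    · omega
    · omega
    · rw [show a = c by omega, show b = d by omega]
  · rintro ⟨m, n⟩
    rcases Int.even_or_odd (m - n) with ⟨j, hj⟩ | ⟨j, hj⟩
    · refine ⟨Sum.inr (m - j, j), ?_⟩
      simp only [Sum.elim_inr, Prod.mk.injEq]
      omega
    · refine ⟨Sum.inl (m - j, j), ?_⟩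
      simp only [Sum.elim_inl, Prod.mk.injEq]
      omega

lemma intProdSumEquiv_inl (k l : ℤ) :
    intProdSumEquiv (Sum.inl (k, l)) = (k + l, k - l - 1) := rfl

lemma intProdSumEquiv_inr (k l : ℤ) :
    intProdSumEquiv (Sum.inr (k, l)) = (k + l, k - l) := rfl

lemma hasSum_thetaTerm_mul (ε ε' δ δ' : ℝ) {τ : ℂ} (hτ : 0 < τ.im) :
    HasSum (fun p : ℤ × ℤ => thetaTerm ε ε' τ p.1 * thetaTerm δ δ' τ p.2)
      (θ ε ε' τ * θ δ δ' τ) := by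
  have hε := summable_thetaTerm ε ε' hτ
  have hδ := summable_thetaTerm δ δ' hτ
  exact hε.hasSum.mul hδ.hasSum (summable_mul_of_summable_norm hε.norm hδ.norm)

/-- The product of two theta constants as an antisymmetric combination of theta constants
at `2 * τ`. -/
lemma theta_mul_theta (x x' y y' : ℝ) {τ : ℂ} (hτ : 0 < τ.im) :
    cexp (2 * Real.pi * I * (-x / 2)) *
        (θ (1 + x + y) (1 + x' + y') τ * θ (1 + x - y) (1 + x' - y') τ) =
      θ x (2 * x') (2 * τ) * θ (1 + y) (2 * y') (2 * τ) -
        θ (1 + x) (2 * x') (2 * τ) * θ y (2 * y') (2 * τ) := by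
  have h2τ : 0 < (2 * τ).im := by simpa using hτ
  have hL := (hasSum_thetaTerm_mul (1 + x + y) (1 + x' + y') (1 + x - y) (1 + x' - y') hτ).mul_left
    (cexp (2 * Real.pi * I * (-x / 2)))
  have hE := hasSum_thetaTerm_mul x (2 * x') (1 + y) (2 * y') h2τ
  have hO := (hasSum_thetaTerm_mul (1 + x) (2 * x') y (2 * y') h2τ).neg
  have hneg (z : ℂ) : -cexp z = cexp (z + Real.pi * I) := by
    rw [Complex.exp_add, Complex.exp_pi_mul_I, mul_neg_one]
  rw [← intProdSumEquiv.hasSum_iff] at hL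
  refine (hL.unique (HasSum.sum ?_ ?_)).trans (sub_eq_add_neg _ _).symm
  · refine Eq.mp (congrArg (HasSum · _) (funext ?_)) hE
    rintro ⟨k, l⟩
    symm
    simp only [Function.comp_apply, intProdSumEquiv_inl, thetaTerm, ← Complex.exp_add]
    rw [Complex.exp_eq_exp_iff_exists_int]
    refine ⟨k, ?_⟩
    push_cast
    ring
  · refine Eq.mp (congrArg (HasSum · _) (funext ?_)) hO
    rintro ⟨k, l⟩
    symm
    simp only [Function.comp_apply, intProdSumEquiv_inr, thetaTerm, ← Complex.exp_add, hneg]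
    rw [Complex.exp_eq_exp_iff_exists_int]
    refine ⟨k, ?_⟩
    push_cast
    ring

theorem rational_expr_two_threefifths (τ : ℂ) (hτ : 0 < τ.im) :
    θ 1 (3/5) τ * θ (1/5) (1/5) τ ^ 3 = -θ (3/5) (7/5) τ ^ 3 * θ (1/5) 1 τ + θ (3/5) (9/5) τ ^ 3 * θ (1/5) (7/5) τ := by
  obtain ⟨v, hv⟩ : ∃ v, v = cexp (2 * Real.pi * I * (-1 / 10)) := ⟨_, rfl⟩
  have hpow (k : ℕ) (t : ℂ) (ht : t = -k / 10) : cexp (2 * Real.pi * I * t) = v ^ k := by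
    rw [hv, ← Complex.exp_nat_mul, ht]
    congr 1
    ring
  have hv5 : v ^ 5 = -1 := by
    rw [← hpow 5 (-1 / 2) (by norm_num)]
    exact (congrArg cexp (by ring)).trans Complex.exp_neg_pi_mul_I
  have h₁ : θ (9/5) (9/5) τ = v * θ (1/5) (1/5) τ := by
    have h := theta_two_sub_two_sub (1/5) (1/5) τ
    rw [hpow 1 _ (by push_cast; ring)] at h
    norm_num at h ⊢
    exact h
  have h₂ : θ (9/5) (-1/5) τ = θ (1/5) (1/5) τ := by
    have h := theta_two_sub_neg (1/5) (1/5) τ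
    norm_num at h ⊢
    exact h
  have h₃ : θ 1 (7/5) τ = -θ 1 (3/5) τ := by
    have h := theta_two_sub_two_sub 1 (3/5) τ
    rw [hpow 5 _ (by push_cast; ring), hv5] at h
    norm_num at h ⊢
    exact h
  have h₄ : θ (7/5) (3/5) τ = v ^ 3 * θ (3/5) (7/5) τ := by
    have h := theta_two_sub_two_sub (3/5) (7/5) τ
    rw [hpow 3 _ (by push_cast; ring)] at h
    norm_num at h ⊢
    exact h
  have h₅ : θ (11/5) 1 τ = θ (1/5) 1 τ := by
    have h := theta_add_two_left (1/5) 1 τ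
    norm_num at h ⊢
    exact h
  have h₆ : v ^ 3 * θ (3/5) (7/5) τ = θ (3/5) (-3/5) τ := by
    have h := theta_sub_two_right (3/5) (7/5) τ
    rw [hpow 3 _ (by push_cast; ring)] at h
    norm_num at h ⊢
    exact h.symm
  have h₇ : θ (7/5) (13/5) τ = v ^ 6 * θ (3/5) (7/5) τ := by
    have h := theta_two_sub_two_sub (3/5) (-3/5) τ
    rw [hpow 3 _ (by push_cast; ring), ← h₆] at h
    norm_num at h ⊢
    rw [h]
    ring
  have h₈ : θ (11/5) (7/5) τ = θ (1/5) (7/5) τ := by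
    have h := theta_add_two_left (1/5) (7/5) τ
    norm_num at h ⊢
    exact h
  have h₉ : θ (3/5) (-1/5) τ = v ^ 3 * θ (3/5) (9/5) τ := by
    have h := theta_sub_two_right (3/5) (9/5) τ
    rw [hpow 3 _ (by push_cast; ring)] at h
    norm_num at h ⊢
    exact h
  have h₁₀ : θ (7/5) (1/5) τ = v ^ 3 * θ (3/5) (9/5) τ := by
    have h := theta_two_sub_two_sub (3/5) (9/5) τ
    rw [hpow 3 _ (by push_cast; ring)] at h
    norm_num at h ⊢
    exact h
  have hxy := theta_mul_theta (4/5) (4/5) 0 0 hτ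
  have hzw := theta_mul_theta (2/5) (-2/5) (2/5) (-4/5) hτ
  have hyz := theta_mul_theta 0 0 (2/5) (-2/5) hτ
  have hxw := theta_mul_theta (4/5) (4/5) (2/5) (-4/5) hτ
  have hzx := theta_mul_theta (2/5) (-2/5) (4/5) (4/5) hτ
  have hyw := theta_mul_theta 0 0 (2/5) (-4/5) hτ
  rw [hpow 4 _ (by push_cast; ring)] at hxy hxw
  rw [hpow 2 _ (by push_cast; ring)] at hzw hzx
  rw [hpow 0 _ (by push_cast; ring)] at hyz hyw
  norm_num at hxy hzw hyz hxw hzx hyw h₁ h₂ h₃ h₄ h₅ h₇ h₈ h₉ h₁₀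
  simp only [h₁, h₂, h₃, h₄, h₅, h₇, h₈, h₉, h₁₀] at hxy hzw hyz hxw hzx hyw
  have hv10 : v ^ 10 = 1 := by linear_combination (v ^ 5 - 1) * hv5
  have hv15 : v ^ 15 = -1 := by linear_combination v ^ 5 * hv10 + hv5
  have key := congrArg₂ (· + ·) (congrArg₂ (· + ·) (congrArg₂ (· * ·) hxy hzw)
    (congrArg₂ (· * ·) hyz hxw)) (congrArg₂ (· * ·) hzx hyw)
  linear_combination (-v ^ 2) * key
    - (θ 1 (3/5) τ * θ (1/5) (1/5) τ ^ 3 - θ (3/5) (9/5) τ ^ 3 * θ (1/5) (7/5) τ) * hv10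
    + θ (3/5) (7/5) τ ^ 3 * θ (1/5) 1 τ * hv15
end

section
/- For every τ in the complex upper half-plane, θ[1,1/5](τ)·θ[1/5,3/5](τ)³ = −ζ₅²·( θ[3/5,1/5](τ)³·θ[1/5,1](τ) + ζ₅³·θ[3/5,7/5](τ)³·θ[1/5,1/5](τ) ). -/
open Complex

lemma hasSum_jacobiTheta₂_mul {τ : ℂ} (hτ : 0 < τ.im) (z w : ℂ) :
    HasSum (fun p : ℤ × ℤ ↦ jacobiTheta₂_term p.1 z τ * jacobiTheta₂_term p.2 w τ)
      (jacobiTheta₂ z τ * jacobiTheta₂ w τ) := by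
  have hz := ((summable_jacobiTheta₂_term_iff z τ).mpr hτ).norm
  have hw := ((summable_jacobiTheta₂_term_iff w τ).mpr hτ).norm
  rw [jacobiTheta₂, jacobiTheta₂, tsum_mul_tsum_of_summable_norm hz hw]
  exact (summable_mul_of_summable_norm hz hw).hasSum

/-- The bijection `(p, q) ↦ (p + q, p - q)`, `(p, q) ↦ (p + q + 1, p - q)` from two copies of `ℤ²`
onto the pairs of integers of equal, resp. different, parity. -/
noncomputable def intPairParityEquiv : (ℤ × ℤ) ⊕ (ℤ × ℤ) ≃ ℤ × ℤ :=
  Equiv.ofBijective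
    (Sum.elim (fun p ↦ (p.1 + p.2, p.1 - p.2)) (fun p ↦ (p.1 + p.2 + 1, p.1 - p.2))) <| by
    constructor
    · rintro (⟨a, b⟩ | ⟨a, b⟩) (⟨c, d⟩ | ⟨c, d⟩) h <;>
        simp only [Sum.elim_inl, Sum.elim_inr, Prod.mk.injEq] at h <;>
        simp only [Sum.inl.injEq, Sum.inr.injEq, Prod.mk.injEq, reduceCtorEq] <;> omega
    · rintro ⟨m, n⟩
      rcases Int.even_or_odd' (m - n) with ⟨k, hk | hk⟩
      · exact ⟨.inl (n + k, k), by simp only [Sum.elim_inl, Prod.mk.injEq]; omega⟩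
      · exact ⟨.inr (n + k, k), by simp only [Sum.elim_inr, Prod.mk.injEq]; omega⟩

lemma intPairParityEquiv_inl (p : ℤ × ℤ) :
    intPairParityEquiv (.inl p) = (p.1 + p.2, p.1 - p.2) := rfl

lemma intPairParityEquiv_inr (p : ℤ × ℤ) :
    intPairParityEquiv (.inr p) = (p.1 + p.2 + 1, p.1 - p.2) := rfl

/-- Splitting a product of theta functions at `τ` into theta functions at `2τ`. -/
lemma jacobiTheta₂_add_mul_sub {τ : ℂ} (hτ : 0 < τ.im) (x y : ℂ) :
    jacobiTheta₂ (x + y) τ * jacobiTheta₂ (x - y) τ =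
      jacobiTheta₂ (2 * x) (2 * τ) * jacobiTheta₂ (2 * y) (2 * τ) +
      Complex.exp (Real.pi * I * (τ + 2 * x + 2 * y)) *
        (jacobiTheta₂ (2 * x + τ) (2 * τ) * jacobiTheta₂ (2 * y + τ) (2 * τ)) := by
  have h2 : 0 < (2 * τ).im := by simpa using hτ
  have h := intPairParityEquiv.hasSum_iff.mpr (hasSum_jacobiTheta₂_mul hτ (x + y) (x - y))
  refine h.unique (HasSum.sum ?_ ?_)
  · convert hasSum_jacobiTheta₂_mul h2 (2 * x) (2 * y) using 2 with p
    simp only [Function.comp_apply, intPairParityEquiv_inl, jacobiTheta₂_term, ← Complex.exp_add]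
    congr 1
    push_cast
    ring
  · have key := (hasSum_jacobiTheta₂_mul h2 (2 * x + τ) (2 * y + τ)).mul_left
      (Complex.exp (Real.pi * I * (τ + 2 * x + 2 * y)))
    refine (congrArg (HasSum · _) (funext fun p ↦ ?_)).mpr key
    simp only [Function.comp_apply, intPairParityEquiv_inr, jacobiTheta₂_term, ← Complex.exp_add]
    congr 1
    push_cast
    ring

/-- The odd theta function, up to a constant factor. -/
noncomputable def oddTheta (τ z : ℂ) : ℂ :=
  Complex.exp (Real.pi * I * z) * jacobiTheta₂ (z + (1 + τ) / 2) τ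

lemma oddTheta_add_one (τ z : ℂ) : oddTheta τ (z + 1) = -oddTheta τ z := by
  rw [oddTheta, oddTheta, show z + 1 + (1 + τ) / 2 = z + (1 + τ) / 2 + 1 by ring,
    jacobiTheta₂_add_left, mul_add, Complex.exp_add, mul_one, Complex.exp_pi_mul_I]
  ring

lemma oddTheta_add_tau (τ z : ℂ) :
    oddTheta τ (z + τ) = -Complex.exp (-Real.pi * I * (τ + 2 * z)) * oddTheta τ z := by
  rw [oddTheta, oddTheta, show z + τ + (1 + τ) / 2 = z + (1 + τ) / 2 + τ by ring,
    jacobiTheta₂_add_left', neg_eq_neg_one_mul (Complex.exp _), ← Complex.exp_pi_mul_I]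
  simp only [← mul_assoc, ← Complex.exp_add]
  congr 1
  rw [Complex.exp_eq_exp_iff_exists_int]
  exact ⟨-1, by push_cast; ring⟩

lemma oddTheta_neg (τ z : ℂ) : oddTheta τ (-z) = -oddTheta τ z := by
  have h := oddTheta_add_one τ (-z - 1)
  rw [sub_add_cancel] at h
  have h' := oddTheta_add_tau τ (-z - 1 - τ)
  rw [sub_add_cancel] at h'
  rw [h, h', oddTheta, oddTheta,
    show -z - 1 - τ + (1 + τ) / 2 = -(z + (1 + τ) / 2) by ring, jacobiTheta₂_neg_left,
    neg_mul, neg_neg, ← mul_assoc, ← Complex.exp_add, ← neg_mul,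
    neg_eq_neg_one_mul (Complex.exp _), ← Complex.exp_pi_mul_I, ← Complex.exp_add]
  congr 1
  rw [Complex.exp_eq_exp_iff_exists_int]
  exact ⟨0, by push_cast; ring⟩

lemma oddTheta_add_mul_sub {τ : ℂ} (hτ : 0 < τ.im) (x y : ℂ) :
    oddTheta τ (x + y) * oddTheta τ (x - y) =
      Complex.exp (2 * Real.pi * I * x) * jacobiTheta₂ (2 * x + τ) (2 * τ) *
        jacobiTheta₂ (2 * y) (2 * τ) -
      Complex.exp (2 * Real.pi * I * y) * jacobiTheta₂ (2 * y + τ) (2 * τ) *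
        jacobiTheta₂ (2 * x) (2 * τ) := by
  have h := jacobiTheta₂_add_mul_sub hτ (x + (1 + τ) / 2) y
  rw [show 2 * (x + (1 + τ) / 2) = 2 * x + τ + 1 by ring, jacobiTheta₂_add_left,
    show 2 * x + τ + 1 + τ = 2 * x + 2 * τ + 1 by ring, jacobiTheta₂_add_left,
    jacobiTheta₂_add_left'] at h
  rw [oddTheta, oddTheta, mul_mul_mul_comm, ← Complex.exp_add,
    show x + y + (1 + τ) / 2 = x + (1 + τ) / 2 + y by ring,
    show x - y + (1 + τ) / 2 = x + (1 + τ) / 2 - y by ring, h,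
    show (Real.pi : ℂ) * I * (x + y) + Real.pi * I * (x - y) = 2 * Real.pi * I * x by ring]
  have e : Complex.exp (2 * Real.pi * I * x) * Complex.exp (Real.pi * I * (τ + (2 * x + τ + 1) + 2 * y)) *
      Complex.exp (-Real.pi * I * (2 * τ + 2 * (2 * x))) = -Complex.exp (2 * Real.pi * I * y) := by
    rw [neg_eq_neg_one_mul (Complex.exp _), ← Complex.exp_pi_mul_I]
    simp only [← Complex.exp_add]
    congr 1
    ring
  linear_combination jacobiTheta₂ (2 * x) (2 * τ) * jacobiTheta₂ (2 * y + τ) (2 * τ) * e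

/-- The Weierstrass three-term identity, with one of the four arguments equal to zero. -/
lemma oddTheta_three_term {τ : ℂ} (hτ : 0 < τ.im) (a b c : ℂ) :
    oddTheta τ (a + b) * oddTheta τ (a - b) * oddTheta τ c ^ 2 +
      oddTheta τ (b + c) * oddTheta τ (b - c) * oddTheta τ a ^ 2 +
      oddTheta τ (c + a) * oddTheta τ (c - a) * oddTheta τ b ^ 2 = 0 := by
  have ha := oddTheta_add_mul_sub hτ a 0
  have hb := oddTheta_add_mul_sub hτ b 0
  have hc := oddTheta_add_mul_sub hτ c 0
  rw [add_zero, sub_zero, ← sq] at ha hb hc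
  rw [ha, hb, hc, oddTheta_add_mul_sub hτ a b, oddTheta_add_mul_sub hτ b c,
    oddTheta_add_mul_sub hτ c a]
  ring

lemma θ_eq_oddTheta (ε ε' : ℝ) (τ : ℂ) :
    θ ε ε' τ = Complex.exp (Real.pi * I * (ε ^ 2 * τ / 4 + ε * ε' / 2 -
      ((ε - 1) * τ + (ε' - 1)) / 2)) * oddTheta τ (((ε - 1) * τ + (ε' - 1)) / 2) := by
  rw [oddTheta, θ, jacobiTheta₂, ← mul_assoc, ← Complex.exp_add, ← tsum_mul_left]
  refine tsum_congr fun n ↦ ?_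
  rw [jacobiTheta₂_term, ← Complex.exp_add]
  congr 1
  ring

lemma oddTheta_fifths {τ : ℂ} (hτ : 0 < τ.im) :
    oddTheta τ (-2 / 5) * oddTheta τ ((-2 * τ - 1) / 5) ^ 3 =
      Complex.exp (-Real.pi * I * (τ + 6) / 5) *
        (oddTheta τ ((-τ + 1) / 5) ^ 3 * oddTheta τ ((-2 * τ - 2) / 5)) +
      Complex.exp (-Real.pi * I * τ / 5) *
        (oddTheta τ ((-τ - 2) / 5) ^ 3 * oddTheta τ (-2 * τ / 5)) := by
  have h := oddTheta_three_term hτ (-((-τ + 1) / 5)) ((-τ - 2) / 5) (-((-2 * τ - 1) / 5))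
  have h1 : oddTheta τ (-((-τ + 1) / 5) + (-τ - 2) / 5) = oddTheta τ (-2 / 5) := by
    have h := oddTheta_add_one τ (-3 / 5)
    rw [show (-3 / 5 + 1 : ℂ) = -(-2 / 5) by ring, oddTheta_neg] at h
    rw [show -((-τ + 1) / 5) + (-τ - 2) / 5 = (-3 / 5 : ℂ) by ring]
    linear_combination h
  have h2 : oddTheta τ ((-τ - 2) / 5 - -((-2 * τ - 1) / 5)) =
      -Complex.exp (-Real.pi * I * (τ + 6) / 5) * oddTheta τ ((-2 * τ - 2) / 5) := by
    have h := oddTheta_add_tau τ ((-3 * τ + 2) / 5 - 1)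
    have h' := oddTheta_add_one τ ((-3 * τ + 2) / 5 - 1 + τ)
    rw [show (-3 * τ + 2) / 5 - 1 + τ + 1 = -((-2 * τ - 2) / 5) by ring, oddTheta_neg, h] at h'
    have e : Complex.exp (-Real.pi * I * (τ + 6) / 5) *
        Complex.exp (-Real.pi * I * (τ + 2 * ((-3 * τ + 2) / 5 - 1))) = 1 := by
      rw [← Complex.exp_add]
      convert Complex.exp_zero using 2
      ring
    rw [show (-τ - 2) / 5 - -((-2 * τ - 1) / 5) = (-3 * τ + 2) / 5 - 1 by ring]
    linear_combination -Complex.exp (-Real.pi * I * (τ + 6) / 5) * h' -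
      oddTheta τ ((-3 * τ + 2) / 5 - 1) * e
  have h3 : oddTheta τ (-((-2 * τ - 1) / 5) + -((-τ + 1) / 5)) =
      -Complex.exp (-Real.pi * I * τ / 5) * oddTheta τ (-2 * τ / 5) := by
    rw [show -((-2 * τ - 1) / 5) + -((-τ + 1) / 5) = -2 * τ / 5 + τ by ring, oddTheta_add_tau,
      show -Real.pi * I * (τ + 2 * (-2 * τ / 5)) = -Real.pi * I * τ / 5 by ring]
  rw [h1, h2, h3, show -((-τ + 1) / 5) - (-τ - 2) / 5 = -((-2 * τ - 1) / 5) by ring,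
    show (-τ - 2) / 5 + -((-2 * τ - 1) / 5) = -((-τ + 1) / 5) by ring,
    show -((-2 * τ - 1) / 5) - -((-τ + 1) / 5) = -((-τ - 2) / 5) by ring] at h
  simp only [oddTheta_neg] at h
  linear_combination -h

theorem rational_expr_four_onefifth (τ : ℂ) (hτ : 0 < τ.im) :
    θ 1 (1/5) τ * θ (1/5) (3/5) τ ^ 3 = -ζ₅ ^ 2 * (θ (3/5) (1/5) τ ^ 3 * θ (1/5) 1 τ + ζ₅ ^ 3 * θ (3/5) (7/5) τ ^ 3 * θ (1/5) (1/5) τ) := by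
  have h := oddTheta_fifths hτ
  simp only [θ_eq_oddTheta, ζ₅, mul_pow, ← Complex.exp_nat_mul]
  push_cast
  rw [show ((1 - 1) * τ + (1 / 5 - 1)) / 2 = (-2 / 5 : ℂ) by ring,
    show ((1 / 5 - 1) * τ + (3 / 5 - 1)) / 2 = (-2 * τ - 1) / 5 by ring,
    show ((3 / 5 - 1) * τ + (1 / 5 - 1)) / 2 = (-τ - 2) / 5 by ring,
    show ((1 / 5 - 1) * τ + (1 - 1)) / 2 = -2 * τ / 5 by ring,
    show ((3 / 5 - 1) * τ + (7 / 5 - 1)) / 2 = (-τ + 1) / 5 by ring,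
    show ((1 / 5 - 1) * τ + (1 / 5 - 1)) / 2 = (-2 * τ - 2) / 5 by ring,
    mul_mul_mul_comm, h]
  have k₁ : Complex.exp (Real.pi * I * (1 ^ 2 * τ / 4 + 1 * (1 / 5) / 2 - -2 / 5)) *
      Complex.exp (3 * (Real.pi * I *
        ((1 / 5) ^ 2 * τ / 4 + 1 / 5 * (3 / 5) / 2 - (-2 * τ - 1) / 5))) *
      Complex.exp (-Real.pi * I * τ / 5) =
    -Complex.exp (2 * (2 * Real.pi * I / 5)) *
      Complex.exp (3 * (Real.pi * I *
        ((3 / 5) ^ 2 * τ / 4 + 3 / 5 * (1 / 5) / 2 - (-τ - 2) / 5))) *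
      Complex.exp (Real.pi * I * ((1 / 5) ^ 2 * τ / 4 + 1 / 5 * 1 / 2 - -2 * τ / 5)) := by
    rw [neg_eq_neg_one_mul (Complex.exp _), ← Complex.exp_pi_mul_I]
    simp only [← Complex.exp_add]
    rw [Complex.exp_eq_exp_iff_exists_int]
    exact ⟨-1, by push_cast; ring⟩
  have k₂ : Complex.exp (Real.pi * I * (1 ^ 2 * τ / 4 + 1 * (1 / 5) / 2 - -2 / 5)) *
      Complex.exp (3 * (Real.pi * I *
        ((1 / 5) ^ 2 * τ / 4 + 1 / 5 * (3 / 5) / 2 - (-2 * τ - 1) / 5))) *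
      Complex.exp (-Real.pi * I * (τ + 6) / 5) =
    -Complex.exp (2 * (2 * Real.pi * I / 5)) * Complex.exp (3 * (2 * Real.pi * I / 5)) *
      Complex.exp (3 * (Real.pi * I *
        ((3 / 5) ^ 2 * τ / 4 + 3 / 5 * (7 / 5) / 2 - (-τ + 1) / 5))) *
      Complex.exp (Real.pi * I *
        ((1 / 5) ^ 2 * τ / 4 + 1 / 5 * (1 / 5) / 2 - (-2 * τ - 2) / 5)) := by
    rw [neg_eq_neg_one_mul (Complex.exp _), ← Complex.exp_pi_mul_I]
    simp only [← Complex.exp_add]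
    rw [Complex.exp_eq_exp_iff_exists_int]
    exact ⟨-2, by push_cast; ring⟩
  linear_combination oddTheta τ ((-τ - 2) / 5) ^ 3 * oddTheta τ (-2 * τ / 5) * k₁ +
    oddTheta τ ((-τ + 1) / 5) ^ 3 * oddTheta τ ((-2 * τ - 2) / 5) * k₂
end
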